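/- arXiv:2402.17253 — 5 statements merged into one kernel-verified Lean document; each statement's English description precedes it below -/
import Mathlib

section
/- Let p ∈ [1,∞), let P : (0,∞) → (0,∞) be a nonincreasing continuous function, and let u : M → ℝ be a bounded measurable function with bounded support, with Euclidean rearrangement u*. Then ∫_M |u(q)|ᵖ P(d(o,q)) dμ(q) ≤ ∫_{ℝⁿ} u*(x)ᵖ P(|x|) dx. -/
open MeasureTheory

/-- The layer cake formula for a product of two nonnegative functions. -/
theorem lintegral_ofReal_mul_eq_lintegral_meas_inter {α : Type*} [MeasurableSpace α]
    (μ : Measure α) {f g : α → ℝ} (hf : Measurable f) (hg : Measurable g)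
    (hf0 : ∀ a, 0 ≤ f a) (hg0 : ∀ a, 0 ≤ g a) :
    ∫⁻ a, ENNReal.ofReal (f a * g a) ∂μ =
      ∫⁻ s in Set.Ioi (0 : ℝ), ∫⁻ t in Set.Ioi (0 : ℝ), μ ({a | t < g a} ∩ {a | s < f a}) := by
  have h1 : ∫⁻ a, ENNReal.ofReal (f a * g a) ∂μ =
      ∫⁻ a, ENNReal.ofReal (f a) ∂(μ.withDensity fun a => ENNReal.ofReal (g a)) := by
    rw [lintegral_withDensity_eq_lintegral_mul _ hg.ennreal_ofReal hf.ennreal_ofReal]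
    refine lintegral_congr fun a => ?_
    rw [Pi.mul_apply, ENNReal.ofReal_mul (hf0 a), mul_comm]
  rw [h1, lintegral_eq_lintegral_meas_lt _ (Filter.Eventually.of_forall hf0) hf.aemeasurable]
  refine lintegral_congr fun s => ?_
  rw [withDensity_apply _ (measurableSet_lt measurable_const hf),
    lintegral_eq_lintegral_meas_lt _ (Filter.Eventually.of_forall hg0) hg.aemeasurable]
  exact lintegral_congr fun t => Measure.restrict_apply (measurableSet_lt measurable_const hg)

/-- A function on a normed space that is nonincreasing in the norm is measurable. -/
theorem measurable_of_norm_antitone {E : Type*} [NormedAddCommGroup E] [NormedSpace ℝ E]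
    [Nontrivial E] [MeasurableSpace E] [BorelSpace E] {v : E → ℝ}
    (hv : ∀ x y, ‖x‖ ≤ ‖y‖ → v y ≤ v x) : Measurable v := by
  obtain ⟨e, he⟩ := exists_norm_eq E zero_le_one
  have hnorm : ∀ r : ℝ, ‖max r 0 • e‖ = max r 0 := fun r => by
    rw [norm_smul, he, mul_one, Real.norm_of_nonneg (le_max_right _ _)]
  have hφ : Antitone fun r : ℝ => v (max r 0 • e) := fun r s hrs =>
    hv _ _ (by rw [hnorm, hnorm]; exact max_le_max_right 0 hrs)
  have hveq : v = (fun r : ℝ => v (max r 0 • e)) ∘ norm := by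
    funext x
    have hx : ‖max ‖x‖ 0 • e‖ = ‖x‖ := by rw [hnorm, max_eq_left (norm_nonneg x)]
    exact le_antisymm (hv _ _ hx.le) (hv _ _ hx.ge)
  rw [hveq]
  exact hφ.measurable.comp measurable_norm

/-- A ball-volume bound forces the base point to be a null set. -/
theorem measure_singleton_eq_zero_of_ball_le {M : Type*} [PseudoMetricSpace M] [MeasurableSpace M]
    {μ : Measure M} {o : M} {n : ℕ} (hn : n ≠ 0) {c : ENNReal} (hc : c ≠ ⊤)
    (hball : ∀ ρ > (0 : ℝ), μ (Metric.ball o ρ) ≤ c * ENNReal.ofReal (ρ ^ n)) : μ {o} = 0 := by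
  have hlim : Filter.Tendsto (fun ρ : ℝ => c * ENNReal.ofReal (ρ ^ n))
      (nhdsWithin 0 (Set.Ioi 0)) (nhds 0) := by
    have hcont : Continuous fun ρ : ℝ => c * ENNReal.ofReal (ρ ^ n) :=
      (ENNReal.continuous_const_mul hc).comp
        (ENNReal.continuous_ofReal.comp (continuous_pow n))
    simpa [hn] using (hcont.tendsto 0).mono_left nhdsWithin_le_nhds
  refine le_antisymm (ge_of_tendsto hlim ?_) zero_le
  filter_upwards [self_mem_nhdsWithin] with ρ hρ
  exact (measure_mono (Set.singleton_subset_iff.2 (Metric.mem_ball_self hρ))).trans (hball ρ hρ)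

/-- Under the Bishop–Gromov bound, the region where the distance to `o` lies in an open initial
segment `I` of `(0, ∞)` has at most the volume of its Euclidean counterpart. -/
theorem measure_dist_mem_le_volume_norm_mem {n : ℕ} [NeZero n]
    {M : Type*} [PseudoMetricSpace M] [MeasurableSpace M] {μ : Measure M} {o : M}
    (hBG : ∀ ρ > (0 : ℝ), μ (Metric.ball o ρ) ≤
      volume (Metric.ball (0 : EuclideanSpace ℝ (Fin n)) 1) * ENNReal.ofReal (ρ ^ n))
    {I : Set ℝ} (hI : IsOpen I) (hpos : I ⊆ Set.Ioi 0)
    (hlower : ∀ r ∈ I, ∀ s, 0 < s → s ≤ r → s ∈ I) :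
    μ {q | dist o q ∈ I} ≤ volume {x : EuclideanSpace ℝ (Fin n) | ‖x‖ ∈ I} := by
  rcases I.eq_empty_or_nonempty with rfl | hne
  · simp
  by_cases hb : BddAbove I
  · have hlt : I ⊆ Set.Iio (sSup I) := by
      rw [← interior_Iic]
      exact interior_maximal (fun r hr => le_csSup hb hr) hI
    have hR : 0 < sSup I := by
      obtain ⟨r, hr⟩ := hne
      exact (hpos hr).trans (hlt hr)
    calc μ {q | dist o q ∈ I} ≤ μ (Metric.ball o (sSup I)) :=
          measure_mono fun q hq => by rw [Metric.mem_ball']; exact hlt hq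
      _ ≤ _ := hBG _ hR
      _ = volume (Metric.ball (0 : EuclideanSpace ℝ (Fin n)) (sSup I)) := by
          rw [Measure.addHaar_ball _ _ hR.le, finrank_euclideanSpace_fin, mul_comm]
      _ = volume (Metric.ball (0 : EuclideanSpace ℝ (Fin n)) (sSup I) \ {0}) :=
          (measure_sdiff_null (measure_singleton _)).symm
      _ ≤ _ := measure_mono fun x hx => by
          obtain ⟨r, hr, hxr⟩ := exists_lt_of_lt_csSup hne (mem_ball_zero_iff.1 hx.1)
          exact hlower r hr _ (norm_pos_iff.2 hx.2) hxr.le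
  · have htop : volume {x : EuclideanSpace ℝ (Fin n) | ‖x‖ ∈ I} = ⊤ := by
      refine top_le_iff.1 ?_
      calc (⊤ : ENNReal) = volume (Set.univ : Set (EuclideanSpace ℝ (Fin n))) :=
            (measure_univ_of_isAddLeftInvariant _).symm
        _ = volume (Set.univ \ {(0 : EuclideanSpace ℝ (Fin n))}) :=
            (measure_sdiff_null (measure_singleton _)).symm
        _ ≤ _ := measure_mono fun x hx => by
            obtain ⟨r, hr, hxr⟩ := not_bddAbove_iff.1 hb ‖x‖
            exact hlower r hr _ (norm_pos_iff.2 hx.2) hxr.le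
    rw [htop]
    exact le_top

/-- Lemma 2 (sym1): for a nonincreasing continuous weight `P : (0,∞) → (0,∞)` and a bounded
measurable function `u` with bounded support, with Euclidean rearrangement `ustar`,
`∫_M |u|ᵖ P(d(o,·)) dμ ≤ ∫_{ℝⁿ} (u*)ᵖ P(|x|) dx`, under the Bishop–Gromov bound on `μ`. -/
theorem weighted_lp_le_rearrangement_of_antitone
    {n : ℕ} (hn : 3 ≤ n)
    {M : Type*} [MetricSpace M] [MeasurableSpace M] [BorelSpace M]
    (μ : Measure M) (o : M)
    (hBG : ∀ ρ > (0 : ℝ), μ (Metric.ball o ρ) ≤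
      volume (Metric.ball (0 : EuclideanSpace ℝ (Fin n)) 1) * ENNReal.ofReal (ρ ^ n))
    (p : ℝ) (hp : 1 ≤ p)
    (P : ℝ → ℝ)
    (hP_pos : ∀ r > (0 : ℝ), 0 < P r)
    (hP_anti : AntitoneOn P (Set.Ioi 0))
    (hP_cont : ContinuousOn P (Set.Ioi 0))
    (u : M → ℝ) (hu_meas : Measurable u)
    (hu_bdd : ∃ C : ℝ, ∀ q, |u q| ≤ C)
    (hu_supp : Bornology.IsBounded (Function.support u))
    (ustar : EuclideanSpace ℝ (Fin n) → ℝ)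
    (h_nonneg : ∀ x, 0 ≤ ustar x)
    (h_radial : ∀ x y, ‖x‖ = ‖y‖ → ustar x = ustar y)
    (h_mono : ∀ x y, ‖x‖ ≤ ‖y‖ → ustar y ≤ ustar x)
    (h_level : ∀ t > (0 : ℝ),
      volume {x | t < ustar x} = μ {q | t < |u q|}) :
    ∫⁻ q, ENNReal.ofReal (|u q| ^ p * P (dist o q)) ∂μ
      ≤ ∫⁻ x, ENNReal.ofReal (ustar x ^ p * P ‖x‖) := by
  have : NeZero n := ⟨by omega⟩
  have hp0 : 0 < p := zero_lt_one.trans_le hp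
  set w : ℝ → ℝ := (Set.Ioi 0).indicator P with hw
  have hw_meas : Measurable w := by
    classical
    rw [hw, ← Set.piecewise_eq_indicator]
    exact hP_cont.measurable_piecewise continuousOn_const measurableSet_Ioi
  have hw_nonneg : ∀ r, 0 ≤ w r := fun r => Set.indicator_nonneg (fun s hs => (hP_pos s hs).le) r
  have hustar_meas : Measurable ustar := measurable_of_norm_antitone h_mono
  have ho : μ {o} = 0 :=
    measure_singleton_eq_zero_of_ball_le (by omega) measure_ball_lt_top.ne hBG
  have hleft : ∫⁻ q, ENNReal.ofReal (|u q| ^ p * P (dist o q)) ∂μ =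
      ∫⁻ q, ENNReal.ofReal (|u q| ^ p * w (dist o q)) ∂μ := by
    refine lintegral_congr_ae ?_
    filter_upwards [measure_eq_zero_iff_ae_notMem.1 ho] with q hq
    have hq' : 0 < dist o q := dist_pos.2 fun h => hq h.symm
    rw [hw, Set.indicator_of_mem (Set.mem_Ioi.2 hq')]
  have hright : ∫⁻ x, ENNReal.ofReal (ustar x ^ p * w ‖x‖) ≤
      ∫⁻ x, ENNReal.ofReal (ustar x ^ p * P ‖x‖) := by
    refine lintegral_mono fun x => ?_
    by_cases hx : 0 < ‖x‖
    · simp only [hw, Set.indicator_of_mem (Set.mem_Ioi.2 hx), le_refl]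
    · simp only [hw, Set.indicator_of_notMem (mt Set.mem_Ioi.1 hx), mul_zero, ENNReal.ofReal_zero,
        zero_le]
  rw [hleft]
  refine le_trans ?_ hright
  have hw_dist : Measurable fun q => w (dist o q) :=
    hw_meas.comp (continuous_const.dist continuous_id).measurable
  have hw_norm : Measurable fun x : EuclideanSpace ℝ (Fin n) => w ‖x‖ :=
    hw_meas.comp measurable_norm
  rw [lintegral_ofReal_mul_eq_lintegral_meas_inter μ (hu_meas.abs.pow_const p) hw_dist
      (fun q => Real.rpow_nonneg (abs_nonneg _) p) (fun q => hw_nonneg _),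
    lintegral_ofReal_mul_eq_lintegral_meas_inter volume (hustar_meas.pow_const p) hw_norm
      (fun x => Real.rpow_nonneg (h_nonneg x) p) (fun x => hw_nonneg _)]
  refine setLIntegral_mono' measurableSet_Ioi fun s hs =>
    setLIntegral_mono' measurableSet_Ioi fun t ht => ?_
  have hs' : 0 < s ^ p⁻¹ := Real.rpow_pos_of_pos hs _
  have hroot : ∀ a : ℝ, 0 ≤ a → (s < a ^ p ↔ s ^ p⁻¹ < a) := fun a ha =>
    (Real.rpow_inv_lt_iff_of_pos (le_of_lt hs) ha hp0).symm
  have hA : {q | s < |u q| ^ p} = {q | s ^ p⁻¹ < |u q|} :=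
    Set.ext fun q => hroot _ (abs_nonneg _)
  have hA' : {x | s < ustar x ^ p} = {x | s ^ p⁻¹ < ustar x} :=
    Set.ext fun x => hroot _ (h_nonneg x)
  have hw_lt : ∀ r, t < w r ↔ r ∈ Set.Ioi 0 ∩ P ⁻¹' Set.Ioi t := fun r => by
    by_cases hr : r ∈ Set.Ioi (0 : ℝ)
    · simp only [hw, Set.indicator_of_mem hr, Set.mem_inter_iff, hr, true_and, Set.mem_preimage,
        Set.mem_Ioi]
    · simp only [hw, Set.indicator_of_notMem hr, Set.mem_inter_iff, hr, false_and, iff_false]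
      exact not_lt.2 (le_of_lt ht)
  have hlower : ∀ r ∈ Set.Ioi 0 ∩ P ⁻¹' Set.Ioi t, ∀ r', 0 < r' → r' ≤ r →
      r' ∈ Set.Ioi 0 ∩ P ⁻¹' Set.Ioi t := fun r hr r' hr' hle =>
    ⟨hr', lt_of_lt_of_le hr.2 (hP_anti hr' hr.1 hle)⟩
  have hB := measure_dist_mem_le_volume_norm_mem hBG
    (hP_cont.isOpen_inter_preimage isOpen_Ioi (isOpen_Ioi (a := t))) Set.inter_subset_left hlower
  simp only [hA, hA', hw_lt]
  by_cases hsub : ∀ y : EuclideanSpace ℝ (Fin n),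
      ‖y‖ ∈ Set.Ioi 0 ∩ P ⁻¹' Set.Ioi t → s ^ p⁻¹ < ustar y
  · exact (measure_mono Set.inter_subset_left).trans
      (hB.trans (measure_mono fun y hy => ⟨hy, hsub y hy⟩))
  · push Not at hsub
    obtain ⟨y, hy, hys⟩ := hsub
    calc _ ≤ μ {q | s ^ p⁻¹ < |u q|} := measure_mono Set.inter_subset_right
      _ = volume {x | s ^ p⁻¹ < ustar x} := (h_level _ hs').symm
      _ = volume ({x | s ^ p⁻¹ < ustar x} \ {0}) :=
          (measure_sdiff_null (measure_singleton _)).symm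
      _ ≤ volume ({x : EuclideanSpace ℝ (Fin n) | ‖x‖ ∈ Set.Ioi 0 ∩ P ⁻¹' Set.Ioi t} ∩
            {x | s ^ p⁻¹ < ustar x}) :=
          measure_mono fun x hx => ⟨hlower _ hy _ (norm_pos_iff.2 hx.2)
            (le_of_not_ge fun h => absurd (hx.1.trans_le (h_mono y x h)) (not_lt.2 hys)), hx.1⟩
end

section
/- Let p ∈ [1,∞), let P : (0,∞) → (0,∞) be an increasing continuous function, and let u : M → ℝ be a bounded measurable function with bounded support, with Euclidean rearrangement u*. Then ∫_M |u(q)|ᵖ P(d(o,q)) dμ(q) ≥ ∫_{ℝⁿ} u*(x)ᵖ P(|x|) dx. -/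
open MeasureTheory Set

/-- Layer cake formula for the integral of a product of two nonnegative functions. -/
theorem lintegral_ofReal_mul_eq_lintegral_meas_lt_inter
    {α : Type*} [MeasurableSpace α] (μ : Measure α) {f g : α → ℝ}
    (hf : Measurable f) (hg : Measurable g) (hf0 : ∀ x, 0 ≤ f x) (hg0 : ∀ x, 0 ≤ g x) :
    ∫⁻ x, ENNReal.ofReal (f x * g x) ∂μ =
      ∫⁻ t in Ioi (0 : ℝ), ∫⁻ s in Ioi (0 : ℝ), μ ({x | s < f x} ∩ {x | t < g x}) := by
  have hfm : Measurable fun x => ENNReal.ofReal (f x) := hf.ennreal_ofReal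
  calc ∫⁻ x, ENNReal.ofReal (f x * g x) ∂μ
      = ∫⁻ x, ENNReal.ofReal (g x) ∂(μ.withDensity fun x => ENNReal.ofReal (f x)) := by
        rw [lintegral_withDensity_eq_lintegral_mul _ hfm hg.ennreal_ofReal]
        exact lintegral_congr fun x => ENNReal.ofReal_mul (hf0 x)
    _ = ∫⁻ t in Ioi (0 : ℝ), (μ.withDensity fun x => ENNReal.ofReal (f x)) {x | t < g x} :=
        lintegral_eq_lintegral_meas_lt _ (Filter.Eventually.of_forall hg0) hg.aemeasurable
    _ = _ := by
        refine lintegral_congr fun t => ?_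
        rw [withDensity_apply _ (measurableSet_lt measurable_const hg),
          lintegral_eq_lintegral_meas_lt _ (Filter.Eventually.of_forall hf0) hf.aemeasurable]
        refine lintegral_congr fun s => ?_
        rw [Measure.restrict_apply (measurableSet_lt measurable_const hf)]

/-- A function on a normed space that is nonincreasing in the norm is measurable. -/
theorem measurable_of_antitone_norm {E : Type*} [NormedAddCommGroup E] [NormedSpace ℝ E]
    [Nontrivial E] [MeasurableSpace E] [BorelSpace E] {f : E → ℝ}
    (hf : ∀ x y, ‖x‖ ≤ ‖y‖ → f y ≤ f x) : Measurable f := by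
  obtain ⟨e, he⟩ := exists_norm_eq E zero_le_one
  have hanti : Antitone fun r : ℝ => f (max r 0 • e) := by
    intro a b hab
    refine hf _ _ ?_
    simp only [norm_smul, he, mul_one, Real.norm_eq_abs,
      abs_of_nonneg (le_max_right a 0), abs_of_nonneg (le_max_right b 0)]
    exact max_le_max_right 0 hab
  have heq : f = (fun r : ℝ => f (max r 0 • e)) ∘ norm := by
    funext x
    have hx : ‖max ‖x‖ 0 • e‖ = ‖x‖ := by simp [norm_smul, he]
    exact le_antisymm (hf _ _ hx.le) (hf _ _ hx.ge)
  rw [heq]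
  exact hanti.measurable.comp measurable_norm

/-- The volume bound on balls passes to preimages of lower sets under the distance function. -/
theorem measure_dist_preimage_le_volume_norm_preimage {n : ℕ} (hn : n ≠ 0)
    {M : Type*} [MetricSpace M] [MeasurableSpace M] (μ : Measure M) (o : M)
    (hBG : ∀ ρ > (0 : ℝ), μ (Metric.ball o ρ) ≤
      volume (Metric.ball (0 : EuclideanSpace ℝ (Fin n)) 1) * ENNReal.ofReal (ρ ^ n))
    {D : Set ℝ} (hD : IsLowerSet D) (h0 : (0 : ℝ) ∈ D) :
    μ {q | dist o q ∈ D} ≤ volume {x : EuclideanSpace ℝ (Fin n) | ‖x‖ ∈ D} := by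
  have : Nonempty (Fin n) := ⟨⟨0, Nat.pos_of_ne_zero hn⟩⟩
  by_cases hb : BddAbove D
  · set ρ := sSup D with hρ
    have hρ0 : 0 ≤ ρ := le_csSup hb h0
    have hcont : Filter.Tendsto (fun r : ℝ =>
        volume (Metric.ball (0 : EuclideanSpace ℝ (Fin n)) 1) * ENNReal.ofReal (r ^ n))
        (nhdsWithin ρ (Ioi ρ))
        (nhds (volume (Metric.ball (0 : EuclideanSpace ℝ (Fin n)) 1) *
          ENNReal.ofReal (ρ ^ n))) := by
      refine ENNReal.Tendsto.const_mul ?_ (Or.inr measure_ball_lt_top.ne)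
      exact (ENNReal.continuous_ofReal.comp (continuous_pow n)).continuousAt.mono_left
        nhdsWithin_le_nhds
    calc μ {q | dist o q ∈ D}
        ≤ volume (Metric.ball (0 : EuclideanSpace ℝ (Fin n)) 1) * ENNReal.ofReal (ρ ^ n) := by
          refine ge_of_tendsto hcont ?_
          filter_upwards [self_mem_nhdsWithin] with r hr
          refine (measure_mono fun q hq => ?_).trans (hBG r (hρ0.trans_lt hr))
          rw [Metric.mem_ball']
          exact (le_csSup hb hq).trans_lt hr
      _ = volume (Metric.ball (0 : EuclideanSpace ℝ (Fin n)) ρ) := by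
          rw [Measure.addHaar_ball _ _ hρ0, finrank_euclideanSpace_fin, mul_comm]
      _ ≤ _ := by
          refine measure_mono fun x hx => ?_
          obtain ⟨r, hr, hxr⟩ := exists_lt_of_lt_csSup ⟨0, h0⟩ (mem_ball_zero_iff.1 hx)
          exact hD hxr.le hr
  · have huniv : {x : EuclideanSpace ℝ (Fin n) | ‖x‖ ∈ D} = univ := by
      refine eq_univ_of_forall fun x => ?_
      obtain ⟨r, hr, hxr⟩ := not_bddAbove_iff.1 hb ‖x‖
      exact hD hxr.le hr
    have : NoncompactSpace (EuclideanSpace ℝ (Fin n)) := NormedSpace.noncompactSpace ℝ _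
    rw [huniv, measure_univ_of_isAddLeftInvariant]
    exact le_top

/-- If `ν B = μ A` is finite, `μ K ≤ ν L`, and `B`, `L` are nested, then
`ν (B \ L) ≤ μ (A \ K)`. -/
theorem measure_diff_le_measure_diff {α β : Type*} [MeasurableSpace α] [MeasurableSpace β]
    {μ : Measure α} {ν : Measure β} {A K : Set α} {B L : Set β}
    (hK : MeasurableSet K) (hL : MeasurableSet L) (hAB : ν B = μ A) (hA : μ A ≠ ⊤)
    (hKL : μ K ≤ ν L) (hnest : B ⊆ L ∨ L ⊆ B) : ν (B \ L) ≤ μ (A \ K) := by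
  rcases hnest with h | h
  · simp [sdiff_eq_empty.2 h]
  · have hμ := measure_inter_add_sdiff (μ := μ) A hK
    have hν := measure_inter_add_sdiff (μ := ν) B hL
    rw [inter_eq_right.2 h] at hν
    have hle : ν L ≤ μ A := hAB ▸ measure_mono h
    refine (ENNReal.add_le_add_iff_left (ne_top_of_le_ne_top hA hle)).1 ?_
    rw [hν, hAB, ← hμ]
    gcongr
    exact (measure_mono inter_subset_right).trans hKL

/-- Lemma 3 (sym2): for an increasing continuous weight `P : (0,∞) → (0,∞)` and a bounded
measurable function `u` with bounded support, with Euclidean rearrangement `ustar`,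
`∫_M |u|ᵖ P(d(o,·)) dμ ≥ ∫_{ℝⁿ} (u*)ᵖ P(|x|) dx`, under the Bishop–Gromov bound on `μ`. -/
theorem weighted_lp_ge_rearrangement_of_monotone
    {n : ℕ} (hn : 3 ≤ n)
    {M : Type*} [MetricSpace M] [MeasurableSpace M] [BorelSpace M]
    (μ : Measure M) (o : M)
    (hBG : ∀ ρ > (0 : ℝ), μ (Metric.ball o ρ) ≤
      volume (Metric.ball (0 : EuclideanSpace ℝ (Fin n)) 1) * ENNReal.ofReal (ρ ^ n))
    (p : ℝ) (hp : 1 ≤ p)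
    (P : ℝ → ℝ)
    (hP_pos : ∀ r > (0 : ℝ), 0 < P r)
    (hP_mono : StrictMonoOn P (Set.Ioi 0))
    (hP_cont : ContinuousOn P (Set.Ioi 0))
    (u : M → ℝ) (hu_meas : Measurable u)
    (hu_bdd : ∃ C : ℝ, ∀ q, |u q| ≤ C)
    (hu_supp : Bornology.IsBounded (Function.support u))
    (ustar : EuclideanSpace ℝ (Fin n) → ℝ)
    (h_nonneg : ∀ x, 0 ≤ ustar x)
    (h_radial : ∀ x y, ‖x‖ = ‖y‖ → ustar x = ustar y)
    (h_mono : ∀ x y, ‖x‖ ≤ ‖y‖ → ustar y ≤ ustar x)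
    (h_level : ∀ t > (0 : ℝ),
      volume {x | t < ustar x} = μ {q | t < |u q|}) :
    ∫⁻ x, ENNReal.ofReal (ustar x ^ p * P ‖x‖)
      ≤ ∫⁻ q, ENNReal.ofReal (|u q| ^ p * P (dist o q)) ∂μ := by
  have hn0 : n ≠ 0 := by omega
  have : Nonempty (Fin n) := ⟨⟨0, by omega⟩⟩
  have hp0 : 0 < p := by linarith
  obtain ⟨R, hR⟩ := (Metric.isBounded_iff_subset_ball o).1 hu_supp
  set Q : ℝ → ℝ := fun r => if 0 < r then P r else 0 with hQ
  have hQ0 : ∀ r, 0 ≤ Q r := fun r => by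
    by_cases hr : 0 < r
    · simpa [hQ, hr] using (hP_pos r hr).le
    · simp [hQ, hr]
  have hQmono : Monotone Q := by
    intro a b hab
    by_cases ha : 0 < a
    · have hb : 0 < b := ha.trans_le hab
      simpa [hQ, ha, hb] using hP_mono.monotoneOn ha hb hab
    · simpa [hQ, ha] using hQ0 b
  have hQP : ∀ r, 0 ≤ r → r ≠ 0 → P r = Q r := fun r hr hr0 => by
    simp [hQ, lt_of_le_of_ne hr hr0.symm]
  have hμo : μ {o} = 0 := by
    have h := measure_dist_preimage_le_volume_norm_preimage hn0 μ o hBG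
      (isLowerSet_Iic (0 : ℝ)) (mem_Iic.2 le_rfl)
    have h1 : {q | dist o q ∈ Iic (0 : ℝ)} = {o} := by
      ext q; simp [eq_comm]
    have h2 : {x : EuclideanSpace ℝ (Fin n) | ‖x‖ ∈ Iic (0 : ℝ)} = {0} := by
      ext x; simp
    rw [h1, h2, measure_singleton (0 : EuclideanSpace ℝ (Fin n))] at h
    exact nonpos_iff_eq_zero.1 h
  have hleft : ∫⁻ x, ENNReal.ofReal (ustar x ^ p * P ‖x‖)
      = ∫⁻ x, ENNReal.ofReal (ustar x ^ p * Q ‖x‖) := by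
    refine lintegral_congr_ae ?_
    filter_upwards [compl_mem_ae_iff.2
      (measure_singleton (μ := volume) (0 : EuclideanSpace ℝ (Fin n)))] with x hx
    rw [hQP _ (norm_nonneg x) (norm_ne_zero_iff.2 hx)]
  have hright : ∫⁻ q, ENNReal.ofReal (|u q| ^ p * P (dist o q)) ∂μ
      = ∫⁻ q, ENNReal.ofReal (|u q| ^ p * Q (dist o q)) ∂μ := by
    refine lintegral_congr_ae ?_
    filter_upwards [compl_mem_ae_iff.2 hμo] with q hq
    rw [hQP _ dist_nonneg (dist_ne_zero.2 fun h => hq h.symm)]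
  have habs : Measurable fun q => |u q| := continuous_abs.measurable.comp hu_meas
  have hdist : Measurable fun q : M => Q (dist o q) :=
    hQmono.measurable.comp (continuous_const.dist continuous_id).measurable
  have hnorm : Measurable fun x : EuclideanSpace ℝ (Fin n) => Q ‖x‖ :=
    hQmono.measurable.comp measurable_norm
  rw [hleft, hright,
    lintegral_ofReal_mul_eq_lintegral_meas_lt_inter volume
      ((measurable_of_antitone_norm h_mono).pow_const p) hnorm
      (fun x => Real.rpow_nonneg (h_nonneg x) p) (fun x => hQ0 _),
    lintegral_ofReal_mul_eq_lintegral_meas_lt_inter μ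
      (habs.pow_const p) hdist
      (fun q => Real.rpow_nonneg (abs_nonneg (u q)) p) (fun q => hQ0 _)]
  refine setLIntegral_mono' measurableSet_Ioi fun t ht =>
    setLIntegral_mono' measurableSet_Ioi fun s hs => ?_
  have ht : 0 < t := ht
  have hs : 0 < s := hs
  have hpow : ∀ y : ℝ, 0 ≤ y → (s < y ^ p ↔ s ^ p⁻¹ < y) := fun y hy =>
    (Real.rpow_inv_lt_iff_of_pos hs.le hy hp0).symm
  have hA : {q | s < |u q| ^ p} = {q | s ^ p⁻¹ < |u q|} := by
    ext q; exact hpow _ (abs_nonneg _)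
  have hB : {x | s < ustar x ^ p} = {x | s ^ p⁻¹ < ustar x} := by
    ext x; exact hpow _ (h_nonneg _)
  have hsp : 0 < s ^ p⁻¹ := Real.rpow_pos_of_pos hs _
  have hA_top : μ {q | s ^ p⁻¹ < |u q|} ≠ ⊤ := by
    have hsub : {q | s ^ p⁻¹ < |u q|} ⊆ Metric.ball o (max R 1) := fun q hq =>
      Metric.ball_subset_ball (le_max_left _ _)
        (hR (abs_pos.1 (hsp.trans hq)))
    refine ne_top_of_le_ne_top ?_
      ((measure_mono hsub).trans (hBG _ (lt_max_of_lt_right one_pos)))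
    exact ENNReal.mul_ne_top measure_ball_lt_top.ne ENNReal.ofReal_ne_top
  have hlower : IsLowerSet {r | Q r ≤ t} := fun a b hba ha => (hQmono hba).trans ha
  have hKL := measure_dist_preimage_le_volume_norm_preimage hn0 μ o hBG hlower
    (show Q 0 ≤ t by simpa [hQ] using ht.le)
  have hnest : {x | s ^ p⁻¹ < ustar x} ⊆ {x | Q ‖x‖ ≤ t} ∨
      {x | Q ‖x‖ ≤ t} ⊆ {x | s ^ p⁻¹ < ustar x} := by
    by_contra! h
    obtain ⟨⟨x, hx, hx'⟩, y, hy, hy'⟩ := h.imp not_subset.1 not_subset.1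
    rcases le_total ‖x‖ ‖y‖ with hxy | hxy
    · exact hx' ((hQmono hxy).trans hy)
    · exact hy' (lt_of_lt_of_le hx (h_mono _ _ hxy))
  have key := measure_diff_le_measure_diff (measurableSet_le hdist measurable_const)
    (measurableSet_le hnorm measurable_const) (h_level _ hsp) hA_top hKL hnest
  rw [hA, hB]
  simpa only [sdiff_eq, compl_ofPred, not_le] using key
end

section
/- Let 1 < p < n, and let u : M → ℝ be a bounded measurable function with bounded support whose Euclidean rearrangement u* : ℝⁿ → [0,∞) is Lipschitz with compact support. Then ((n−p)/p)ᵖ ∫_M |u(q)|ᵖ / d(o,q)ᵖ dμ(q) ≤ ∫_{ℝⁿ} |∇u*(x)|ᵖ dx. -/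
open MeasureTheory Set

/-- Integration of a radial function in polar coordinates, for the Lebesgue integral. -/
theorem lintegral_fun_norm_addHaar {E : Type*} [NormedAddCommGroup E] [NormedSpace ℝ E]
    [MeasurableSpace E] [BorelSpace E] [FiniteDimensional ℝ E] [Nontrivial E]
    (μ : Measure E) [μ.IsAddHaarMeasure] {f : ℝ → ENNReal} (hf : Measurable f) :
    ∫⁻ x, f ‖x‖ ∂μ = Module.finrank ℝ E * μ (Metric.ball 0 1) *
      ∫⁻ r in Ioi (0 : ℝ), ENNReal.ofReal (r ^ (Module.finrank ℝ E - 1)) * f r := by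
  have hsub : Measurable fun r : Ioi (0 : ℝ) ↦ f r := hf.comp measurable_subtype_coe
  calc
    ∫⁻ x, f ‖x‖ ∂μ = ∫⁻ x : ({0}ᶜ : Set E), f ‖x.1‖ ∂(μ.comap (↑)) := by
      rw [lintegral_subtype_comap (measurableSet_singleton _).compl fun x ↦ f ‖x‖,
        restrict_compl_singleton]
    _ = ∫⁻ x, f x.2 ∂μ.toSphere.prod (.volumeIoiPow (Module.finrank ℝ E - 1)) := by
      simpa using μ.measurePreserving_homeomorphUnitSphereProd.lintegral_comp
        (hsub.comp measurable_snd)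
    _ = μ.toSphere univ * ∫⁻ r : Ioi (0 : ℝ), f r ∂.volumeIoiPow (Module.finrank ℝ E - 1) := by
      rw [lintegral_prod (fun x : _ × Ioi (0 : ℝ) ↦ f x.2)
        (hsub.comp measurable_snd).aemeasurable]
      simp [mul_comm]
    _ = _ := by
      rw [μ.toSphere_apply_univ, Measure.volumeIoiPow,
        lintegral_withDensity_eq_lintegral_mul _ (by fun_prop) hsub]
      congr 1
      exact lintegral_subtype_comap measurableSet_Ioi
        fun r ↦ ENNReal.ofReal (r ^ (Module.finrank ℝ E - 1)) * f r

/-- Young's inequality with the weights appearing in Hardy's inequality. -/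
theorem mul_rpow_sub_one_mul_le {p x y : ℝ} (hp : 1 < p) (hx : 0 ≤ x) (hy : 0 ≤ y) :
    p * (x ^ (p - 1) * y) ≤ (p - 1) * x ^ p + y ^ p := by
  have hp0 : 0 < p := by linarith
  have hpq := (Real.HolderConjugate.conjExponent hp).symm
  have h := Real.young_inequality_of_nonneg (Real.rpow_nonneg hx (p - 1)) hy hpq
  rw [← Real.rpow_mul hx, Real.conjExponent, mul_div_cancel₀ _ (by linarith : p - 1 ≠ 0)] at h
  calc p * (x ^ (p - 1) * y) ≤ p * (x ^ p / (p / (p - 1)) + y ^ p / p) := by gcongr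
    _ = _ := by
      have : p - 1 ≠ 0 := by linarith
      field_simp

/-- The pointwise inequality behind the one-dimensional Hardy inequality. -/
theorem hardy_pointwise {d : ℕ} (hd : 0 < d) {p r a b : ℝ} (hp : 1 < p) (hpd : p < d)
    (hr : 0 < r) (ha : 0 ≤ a) :
    r ^ (d - 1) * ((d - p) / p * (a / r)) ^ p - r ^ (d - 1) * |b| ^ p ≤
      ((d - p) / p) ^ (p - 1) * ((d - p) * r ^ ((d : ℝ) - p - 1) * a ^ p +
        r ^ ((d : ℝ) - p) * (b * p * a ^ (p - 1))) := by
  have hp0 : 0 < p := by linarith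
  set c : ℝ := (d - p) / p with hc
  have hc0 : 0 < c := div_pos (by linarith) hp0
  have hdc : (d : ℝ) - p = p * c := by rw [hc]; field_simp
  set x := a / r with hx
  have hx0 : 0 ≤ x := by positivity
  have hax : a = r * x := by rw [hx]; field_simp
  have hw : r ^ (d - 1) = r ^ ((d : ℝ) - 1) := by
    rw [← Real.rpow_natCast, Nat.cast_sub hd, Nat.cast_one]
  have e1 : r ^ ((d : ℝ) - p - 1) * a ^ p = r ^ (d - 1) * x ^ p := by
    rw [hax, Real.mul_rpow hr.le hx0, ← mul_assoc, ← Real.rpow_add hr, hw]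
    ring_nf
  have e2 : r ^ ((d : ℝ) - p) * a ^ (p - 1) = r ^ (d - 1) * x ^ (p - 1) := by
    rw [hax, Real.mul_rpow hr.le hx0, ← mul_assoc, ← Real.rpow_add hr, hw]
    ring_nf
  have e3 : c ^ (p - 1) * c = c ^ p := by
    rw [← Real.rpow_add_one hc0.ne']; ring_nf
  have hy := mul_rpow_sub_one_mul_le hp (mul_nonneg hc0.le hx0) (abs_nonneg b)
  have hb : -(p * ((c * x) ^ (p - 1) * |b|)) ≤ p * ((c * x) ^ (p - 1) * b) := by
    rw [← mul_neg, ← mul_neg]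
    gcongr
    exact neg_abs_le b
  have hrhs : c ^ (p - 1) * ((d - p) * r ^ ((d : ℝ) - p - 1) * a ^ p +
        r ^ ((d : ℝ) - p) * (b * p * a ^ (p - 1))) =
      r ^ (d - 1) * (p * (c * x) ^ p + p * ((c * x) ^ (p - 1) * b)) := by
    rw [Real.mul_rpow hc0.le hx0, Real.mul_rpow hc0.le hx0, ← e3, mul_assoc (_ - _), e1]
    linear_combination c ^ (p - 1) * b * p * e2 + c ^ (p - 1) * r ^ (d - 1) * x ^ p * hdc
  rw [hrhs, ← mul_sub]
  gcongr
  linarith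

/-- Powers `p ≥ 1` of nonnegative Lipschitz functions are absolutely continuous. -/
theorem LipschitzWith.absolutelyContinuousOnInterval_rpow {g : ℝ → ℝ} {K : NNReal}
    (hg : LipschitzWith K g) (hg0 : ∀ r, 0 ≤ g r)
    {p : ℝ} (hp : 1 ≤ p) (a b : ℝ) :
    AbsolutelyContinuousOnInterval (fun r ↦ g r ^ p) a b := by
  obtain ⟨B, hB⟩ := isCompact_uIcc.exists_bound_of_continuousOn
    (hg.continuous.continuousOn (s := uIcc a b))
  have h1 : ContDiff ℝ 1 fun x : ℝ ↦ x ^ p :=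
    Real.contDiff_rpow_const_of_le (n := 1) (by simpa using hp)
  obtain ⟨L, hL⟩ := (h1.contDiffOn (s := Icc 0 B)).exists_lipschitzOnWith (by decide)
    (convex_Icc _ _) isCompact_Icc
  exact (hL.comp hg.lipschitzOnWith fun r hr ↦
    ⟨hg0 r, (le_abs_self _).trans (hB r hr)⟩).absolutelyContinuousOnInterval

/-- One-dimensional weighted Hardy inequality on an interval away from the origin. -/
theorem hardy_Ioc {d : ℕ} (hd : 0 < d) {p : ℝ} (hp : 1 < p) (hpd : p < d)
    {g : ℝ → ℝ} {K : NNReal} (hg : LipschitzWith K g) (hg0 : ∀ r, 0 ≤ g r)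
    {ε R : ℝ} (hε : 0 < ε) (hεR : ε ≤ R) (hR : g R = 0) :
    ∫⁻ r in Ioc ε R, ENNReal.ofReal (r ^ (d - 1) * (((d - p) / p) * (g r / r)) ^ p) ≤
      ∫⁻ r in Ioc ε R, ENNReal.ofReal (r ^ (d - 1) * |deriv g r| ^ p) := by
  have hp0 : 0 < p := by linarith
  have hc0 : 0 < ((d : ℝ) - p) / p := div_pos (by linarith) hp0
  have hpos : ∀ r ∈ uIcc ε R, r ≠ 0 := fun r hr ↦ by
    rw [uIcc_of_le hεR] at hr; exact (hε.trans_le hr.1).ne'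
  have hac1 : AbsolutelyContinuousOnInterval (fun r : ℝ ↦ r ^ ((d : ℝ) - p)) ε R :=
    ContDiffOn.absolutelyContinuousOnInterval fun r hr ↦
      (Real.contDiffAt_rpow_const_of_ne (hpos r hr)).contDiffWithinAt
  have hac2 := hg.absolutelyContinuousOnInterval_rpow hg0 hp.le ε R
  have hac := hac1.fun_mul hac2
  have hint1 : IntervalIntegrable
      (fun r ↦ r ^ (d - 1) * (((d - p) / p) * (g r / r)) ^ p) volume ε R := by
    apply ContinuousOn.intervalIntegrable
    have := hg.continuous
    exact (continuousOn_id.pow _).mul (((continuousOn_const).mul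
      (this.continuousOn.div continuousOn_id hpos)).rpow_const fun _ _ ↦ Or.inr hp0.le)
  have hint2 : IntervalIntegrable (fun r ↦ r ^ (d - 1) * |deriv g r| ^ p) volume ε R := by
    refine IntervalIntegrable.continuousOn_mul ?_ (by fun_prop)
    refine (intervalIntegrable_const (c := (K : ℝ) ^ p)).mono_fun
      ((measurable_deriv g).abs.pow_const p).aestronglyMeasurable (.of_forall fun r ↦ ?_)
    have : |deriv g r| ≤ K := norm_deriv_le_of_lipschitz hg
    simp only [Real.norm_of_nonneg (Real.rpow_nonneg (abs_nonneg (deriv g r)) p),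
      Real.norm_of_nonneg (Real.rpow_nonneg K.coe_nonneg p)]
    gcongr
  have key : ∫ r in ε..R, (r ^ (d - 1) * (((d - p) / p) * (g r / r)) ^ p -
      r ^ (d - 1) * |deriv g r| ^ p) ≤ ∫ r in ε..R, (((d - p) / p) ^ (p - 1) *
        deriv (fun r ↦ r ^ ((d : ℝ) - p) * g r ^ p) r) := by
    apply intervalIntegral.integral_mono_ae_restrict hεR (hint1.sub hint2)
      (hac.intervalIntegrable_deriv.const_mul _)
    filter_upwards [ae_restrict_mem measurableSet_Icc,
      ae_restrict_of_ae hg.ae_differentiableAt_real] with r hr hgr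
    have hr0 : 0 < r := hε.trans_le hr.1
    have h1 := (Real.hasDerivAt_rpow_const (p := (d : ℝ) - p) (Or.inl hr0.ne')).mul
      (hgr.hasDerivAt.rpow_const (p := p) (Or.inr hp.le))
    rw [show deriv (fun r ↦ r ^ ((d : ℝ) - p) * g r ^ p) r = _ from h1.deriv]
    exact hardy_pointwise hd hp hpd hr0 (hg0 r)
  rw [intervalIntegral.integral_const_mul, hac.integral_deriv_eq_sub, hR,
    Real.zero_rpow hp0.ne', intervalIntegral.integral_sub hint1 hint2] at key
  have hnn : 0 ≤ ((d - p) / p) ^ (p - 1) * (ε ^ ((d : ℝ) - p) * g ε ^ p) := by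
    have := hg0 ε
    positivity
  rw [← ofReal_integral_eq_lintegral_ofReal hint1.1, ← ofReal_integral_eq_lintegral_ofReal hint2.1,
    ← intervalIntegral.integral_of_le hεR, ← intervalIntegral.integral_of_le hεR]
  · apply ENNReal.ofReal_le_ofReal
    linarith
  all_goals
    filter_upwards [ae_restrict_mem measurableSet_Ioc] with r hr
    have hr0 : 0 < r := hε.trans hr.1
    have := hg0 r
    simp only [Pi.zero_apply]
    positivity

/-- One-dimensional weighted Hardy inequality on the half-line. -/
theorem hardy_Ioi {d : ℕ} (hd : 0 < d) {p : ℝ} (hp : 1 < p) (hpd : p < d)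
    {g : ℝ → ℝ} {K : NNReal} (hg : LipschitzWith K g) (hg0 : ∀ r, 0 ≤ g r)
    {R : ℝ} (hR : ∀ r, R ≤ r → g r = 0) :
    ∫⁻ r in Ioi 0, ENNReal.ofReal (r ^ (d - 1) * (((d - p) / p) * (g r / r)) ^ p) ≤
      ∫⁻ r in Ioi 0, ENNReal.ofReal (r ^ (d - 1) * |deriv g r| ^ p) := by
  have hU : Ioi (0 : ℝ) = ⋃ k : ℕ, Ioc (1 / ((k : ℝ) + 1)) (max R 1 + k) := by
    ext r
    simp only [mem_Ioi, mem_iUnion, mem_Ioc]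
    constructor
    · intro hr
      obtain ⟨k, hk⟩ := exists_nat_one_div_lt hr
      obtain ⟨m, hm⟩ := exists_nat_ge r
      refine ⟨max k m, (one_div_le_one_div_of_le (by positivity) ?_).trans_lt hk, ?_⟩
      · gcongr; exact le_max_left _ _
      · have : (m : ℝ) ≤ (max k m : ℕ) := by gcongr; exact le_max_right _ _
        linarith [le_max_right R 1]
    · rintro ⟨k, hk, -⟩
      exact lt_trans (by positivity) hk
  have hmono : Monotone fun k : ℕ ↦ Ioc (1 / ((k : ℝ) + 1)) (max R 1 + k) := by
    intro k m hkm
    apply Ioc_subset_Ioc <;> gcongr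
  rw [hU, setLIntegral_iUnion_of_directed _ hmono.directed_le]
  refine iSup_le fun k ↦ (hardy_Ioc hd hp hpd hg hg0 (by positivity) ?_
    (hR _ ?_)).trans (lintegral_mono_set (subset_iUnion
      (fun k : ℕ ↦ Ioc (1 / ((k : ℝ) + 1)) (max R 1 + k)) k))
  · have : 1 / ((k : ℝ) + 1) ≤ 1 := by
      rw [div_le_one (by positivity)]; linarith [k.cast_nonneg (α := ℝ)]
    linarith [le_max_right R 1, k.cast_nonneg (α := ℝ)]
  · linarith [le_max_left R 1, k.cast_nonneg (α := ℝ)]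

/-- Layer cake formula for the integral of a product. -/
theorem lintegral_ofReal_mul_eq_lintegral_meas_lt {X : Type*} [MeasurableSpace X] (μ : Measure X)
    {F G : X → ℝ} (hF : Measurable F) (hG : Measurable G) (hF0 : 0 ≤ F) (hG0 : 0 ≤ G) :
    ∫⁻ x, ENNReal.ofReal (F x * G x) ∂μ =
      ∫⁻ s in Ioi (0 : ℝ), ∫⁻ t in Ioi (0 : ℝ), μ ({x | s < F x} ∩ {x | t < G x}) := by
  have hGm : Measurable fun x ↦ ENNReal.ofReal (G x) := hG.ennreal_ofReal
  calc ∫⁻ x, ENNReal.ofReal (F x * G x) ∂μ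
      = ∫⁻ x, ENNReal.ofReal (F x) ∂μ.withDensity fun x ↦ ENNReal.ofReal (G x) := by
        rw [lintegral_withDensity_eq_lintegral_mul _ hGm hF.ennreal_ofReal]
        refine lintegral_congr fun x ↦ ?_
        rw [ENNReal.ofReal_mul (hF0 x), Pi.mul_apply, mul_comm]
    _ = _ := by
        rw [lintegral_eq_lintegral_meas_lt _ (.of_forall hF0) hF.aemeasurable]
        refine lintegral_congr fun s ↦ ?_
        have hs : MeasurableSet {x | s < F x} := measurableSet_lt measurable_const hF
        rw [withDensity_apply _ hs,
          lintegral_eq_lintegral_meas_lt _ (.of_forall hG0) hG.aemeasurable]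
        refine lintegral_congr fun t ↦ ?_
        rw [Measure.restrict_apply (measurableSet_lt measurable_const hG), inter_comm]

/-- Hardy–Littlewood comparison of the Hardy integral of `u` with that of its rearrangement `v`,
for a measure whose balls around `o` are no larger than those of `ν` around `0`. -/
theorem lintegral_div_dist_rpow_le_lintegral_div_norm_rpow
    {E : Type*} [NormedAddCommGroup E] [NormedSpace ℝ E] [MeasurableSpace E] [BorelSpace E]
    [FiniteDimensional ℝ E] [Nontrivial E] (ν : Measure E) [ν.IsAddHaarMeasure]
    {M : Type*} [PseudoMetricSpace M] [MeasurableSpace M] [BorelSpace M] (μ : Measure M) (o : M)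
    (hBG : ∀ ρ > (0 : ℝ), μ (Metric.ball o ρ) ≤ ν (Metric.ball 0 ρ))
    {p : ℝ} (hp : 0 < p) {u : M → ℝ} (hu : Measurable u)
    {v : E → ℝ} (hv : Measurable v) (hv0 : ∀ x, 0 ≤ v x)
    (hmono : ∀ x y, ‖x‖ ≤ ‖y‖ → v y ≤ v x)
    (hlevel : ∀ t > (0 : ℝ), ν {x | t < v x} = μ {q | t < |u q|}) :
    ∫⁻ q, ENNReal.ofReal (|u q| ^ p / dist o q ^ p) ∂μ ≤
      ∫⁻ x, ENNReal.ofReal (v x ^ p / ‖x‖ ^ p) ∂ν := by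
  simp only [div_eq_mul_inv]
  have hdist : Measurable fun q ↦ dist o q := (continuous_const.dist continuous_id).measurable
  rw [lintegral_ofReal_mul_eq_lintegral_meas_lt μ (hu.abs.pow_const p)
      (G := fun q ↦ (dist o q ^ p)⁻¹) (hdist.pow_const p).inv
      (fun _ ↦ by dsimp; positivity) (fun _ ↦ by dsimp; positivity),
    lintegral_ofReal_mul_eq_lintegral_meas_lt ν (hv.pow_const p)
      (G := fun x ↦ (‖x‖ ^ p)⁻¹) (measurable_norm.pow_const p).inv
      (fun x ↦ Real.rpow_nonneg (hv0 x) p)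
      (fun _ ↦ by dsimp; positivity)]
  refine setLIntegral_mono' measurableSet_Ioi fun s hs ↦
    setLIntegral_mono' measurableSet_Ioi fun t ht ↦ ?_
  have hs0 : 0 < s := hs
  have ht0 : 0 < t := ht
  have hlt : ∀ y : ℝ, 0 ≤ y → (s < y ^ p ↔ s ^ p⁻¹ < y) := fun y hy ↦
    (Real.rpow_inv_lt_iff_of_pos hs0.le hy hp).symm
  set ρ : ℝ := t⁻¹ ^ p⁻¹ with hρ
  have hρ0 : 0 < ρ := by positivity
  have hball : ∀ y : ℝ, 0 < y → (t < (y ^ p)⁻¹ ↔ y < ρ) := fun y hy ↦ by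
    rw [hρ, Real.lt_rpow_inv_iff_of_pos hy.le (by positivity) hp,
      lt_inv_comm₀ ht0 (by positivity)]
  have hA : μ {q | s < |u q| ^ p} = ν {x | s < v x ^ p} := by
    simp only [hlt _ (abs_nonneg _), hlt _ (hv0 _)]
    exact (hlevel _ (by positivity)).symm
  have hB : μ {q | t < (dist o q ^ p)⁻¹} ≤ ν (Metric.ball 0 ρ) := by
    refine (measure_mono fun q hq ↦ ?_).trans (hBG ρ hρ0)
    rw [Metric.mem_ball']
    rcases (dist_nonneg : 0 ≤ dist o q).eq_or_lt with h | h
    · rwa [← h]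
    · exact (hball _ h).1 hq
  have hB' : ν ({x | s < v x ^ p} ∩ Metric.ball 0 ρ) ≤
      ν ({x | s < v x ^ p} ∩ {x | t < (‖x‖ ^ p)⁻¹}) := by
    rw [← measure_sdiff_null (measure_singleton (μ := ν) (0 : E))]
    refine measure_mono fun x ⟨⟨hx1, hx2⟩, hx0⟩ ↦ ⟨hx1, ?_⟩
    exact (hball _ (norm_pos_iff.2 hx0)).2 (mem_ball_zero_iff.1 hx2)
  refine le_trans ?_ hB'
  by_cases h : {x | s < v x ^ p} ⊆ Metric.ball 0 ρ
  · rw [inter_eq_left.2 h, ← hA]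
    exact measure_mono inter_subset_left
  · obtain ⟨x, hx, hxρ⟩ := not_subset.1 h
    rw [Metric.mem_ball, dist_zero_right, not_lt] at hxρ
    have hsub : Metric.ball 0 ρ ⊆ {x | s < v x ^ p} := fun y hy ↦ by
      have hyx : ‖y‖ ≤ ‖x‖ := (mem_ball_zero_iff.1 hy).le.trans hxρ
      exact lt_of_lt_of_le hx (Real.rpow_le_rpow (hv0 x) (hmono y x hyx) hp.le)
    rw [inter_eq_right.2 hsub]
    exact (measure_mono inter_subset_right).trans hB

/-- Hardy's inequality for radial Lipschitz functions with compact support. -/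
theorem hardy_radial
    {E : Type*} [NormedAddCommGroup E] [NormedSpace ℝ E] [MeasurableSpace E] [BorelSpace E]
    [FiniteDimensional ℝ E] [Nontrivial E] (ν : Measure E) [ν.IsAddHaarMeasure]
    {p : ℝ} (hp : 1 < p) (hpd : p < Module.finrank ℝ E)
    {v : E → ℝ} (hv0 : ∀ x, 0 ≤ v x) (hrad : ∀ x y, ‖x‖ = ‖y‖ → v x = v y)
    {K : NNReal} (hv : LipschitzWith K v) (hcpt : HasCompactSupport v) :
    ENNReal.ofReal (((Module.finrank ℝ E - p) / p) ^ p) *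
        ∫⁻ x, ENNReal.ofReal (v x ^ p / ‖x‖ ^ p) ∂ν ≤
      ∫⁻ x, ENNReal.ofReal (‖fderiv ℝ v x‖ ^ p) ∂ν := by
  set d := Module.finrank ℝ E with hd
  have hp0 : 0 < p := by linarith
  have hc0 : 0 < ((d : ℝ) - p) / p := div_pos (by linarith) hp0
  have hd0 : 0 < d := Module.finrank_pos
  obtain ⟨e, he⟩ := exists_norm_eq E zero_le_one
  set g : ℝ → ℝ := fun r ↦ v (r • e) with hg
  have hgLip : LipschitzWith K g := LipschitzWith.of_dist_le_mul fun r s ↦ by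
    refine (hv.dist_le_mul _ _).trans_eq ?_
    rw [dist_eq_norm, ← sub_smul, norm_smul, he, mul_one, Real.dist_eq, Real.norm_eq_abs]
  have hgv : ∀ x, g ‖x‖ = v x := fun x ↦ hrad _ _ (by simp [norm_smul, he])
  obtain ⟨R, hR⟩ := hcpt.isCompact.isBounded.exists_norm_le
  have hgR : ∀ r, max R 0 + 1 ≤ r → g r = 0 := fun r hr ↦ by
    by_contra h
    have h1 := hR _ (subset_tsupport v h)
    rw [norm_smul, he, mul_one, Real.norm_eq_abs] at h1
    linarith [le_abs_self r, le_max_left R 0]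
  have hgrad : ∀ᵐ x ∂ν, |deriv g ‖x‖| ≤ ‖fderiv ℝ v x‖ := by
    filter_upwards [hv.ae_differentiableAt (μ := ν), Measure.ae_ne ν 0] with x hx hx0
    have hn : ‖x‖ ≠ 0 := norm_ne_zero_iff.2 hx0
    set w : E := ‖x‖⁻¹ • x with hw
    have hw1 : ‖w‖ = 1 := by simp [hw, norm_smul, hn]
    have hxw : ‖x‖ • w = x := by simp [hw, smul_smul, hn]
    have hgw : g = fun r ↦ v (r • w) := funext fun r ↦ hrad _ _ (by simp [norm_smul, he, hw1])
    have h1 : HasDerivAt (fun r : ℝ ↦ r • w) w ‖x‖ := by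
      simpa using (hasDerivAt_id ‖x‖).smul_const w
    have h2 : HasFDerivAt v (fderiv ℝ v x) (‖x‖ • w) := by rw [hxw]; exact hx.hasFDerivAt
    rw [hgw, show deriv (fun r ↦ v (r • w)) ‖x‖ = _ from (h2.comp_hasDerivAt _ h1).deriv]
    simpa [hw1] using (fderiv ℝ v x).le_opNorm w
  have hgm : Measurable g := hgLip.continuous.measurable
  calc _ = ∫⁻ x, ENNReal.ofReal (((d - p) / p * (g ‖x‖ / ‖x‖)) ^ p) ∂ν := by
        rw [← lintegral_const_mul' _ _ ENNReal.ofReal_ne_top]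
        refine lintegral_congr fun x ↦ ?_
        rw [hgv, ← ENNReal.ofReal_mul (by positivity), ← Real.div_rpow (hv0 x) (norm_nonneg x),
          Real.mul_rpow hc0.le (div_nonneg (hv0 x) (norm_nonneg x))]
    _ ≤ ∫⁻ x, ENNReal.ofReal (|deriv g ‖x‖| ^ p) ∂ν := by
        rw [lintegral_fun_norm_addHaar ν
            (f := fun r ↦ ENNReal.ofReal (((d - p) / p * (g r / r)) ^ p)) (by fun_prop),
          lintegral_fun_norm_addHaar ν (f := fun r ↦ ENNReal.ofReal (|deriv g r| ^ p))
            ((measurable_deriv g).abs.pow_const p).ennreal_ofReal]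
        gcongr _ * ?_
        have hmul (h : ℝ → ℝ) :
            ∫⁻ r in Ioi (0 : ℝ), ENNReal.ofReal (r ^ (d - 1)) * ENNReal.ofReal (h r) =
              ∫⁻ r in Ioi (0 : ℝ), ENNReal.ofReal (r ^ (d - 1) * h r) :=
          setLIntegral_congr_fun measurableSet_Ioi fun r hr ↦
            (ENNReal.ofReal_mul (pow_nonneg (mem_Ioi.1 hr).le _)).symm
        rw [hmul, hmul]
        exact hardy_Ioi hd0 hp hpd hgLip (fun r ↦ hv0 _) hgR
    _ ≤ _ := by
        refine lintegral_mono_ae (hgrad.mono fun x hx ↦ ?_)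
        gcongr

/-- Hardy inequality step on `M`: for `1 < p < n`, a bounded measurable `u` with bounded
support whose Euclidean rearrangement `ustar` is Lipschitz with compact support,
`((n−p)/p)ᵖ ∫_M |u|ᵖ/d(o,·)ᵖ dμ ≤ ∫_{ℝⁿ} |∇u*|ᵖ dx`, under the Bishop–Gromov bound. -/
theorem hardy_via_rearrangement
    {n : ℕ} (hn : 3 ≤ n)
    {M : Type*} [MetricSpace M] [MeasurableSpace M] [BorelSpace M]
    (μ : Measure M) (o : M)
    (hBG : ∀ ρ > (0 : ℝ), μ (Metric.ball o ρ) ≤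
      volume (Metric.ball (0 : EuclideanSpace ℝ (Fin n)) 1) * ENNReal.ofReal (ρ ^ n))
    (p : ℝ) (hp1 : 1 < p) (hpn : p < n)
    (u : M → ℝ) (hu_meas : Measurable u)
    (hu_bdd : ∃ C : ℝ, ∀ q, |u q| ≤ C)
    (hu_supp : Bornology.IsBounded (Function.support u))
    (ustar : EuclideanSpace ℝ (Fin n) → ℝ)
    (h_nonneg : ∀ x, 0 ≤ ustar x)
    (h_radial : ∀ x y, ‖x‖ = ‖y‖ → ustar x = ustar y)
    (h_mono : ∀ x y, ‖x‖ ≤ ‖y‖ → ustar y ≤ ustar x)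
    (h_level : ∀ t > (0 : ℝ),
      volume {x | t < ustar x} = μ {q | t < |u q|})
    (h_lip : ∃ K : NNReal, LipschitzWith K ustar)
    (h_cpt : HasCompactSupport ustar) :
    ENNReal.ofReal ((((n : ℝ) - p) / p) ^ p) *
        ∫⁻ q, ENNReal.ofReal (|u q| ^ p / dist o q ^ p) ∂μ
      ≤ ∫⁻ x, ENNReal.ofReal (‖fderiv ℝ ustar x‖ ^ p) := by
  obtain ⟨K, hK⟩ := h_lip
  have : Nonempty (Fin n) := ⟨⟨0, by lia⟩⟩
  have hfin : Module.finrank ℝ (EuclideanSpace ℝ (Fin n)) = n := finrank_euclideanSpace_fin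
  have hBG' : ∀ ρ > (0 : ℝ), μ (Metric.ball o ρ) ≤
      volume (Metric.ball (0 : EuclideanSpace ℝ (Fin n)) ρ) := fun ρ hρ ↦ by
    rw [Measure.addHaar_ball_of_pos volume _ hρ, hfin, mul_comm]
    exact hBG ρ hρ
  have hardy := hardy_radial (volume : Measure (EuclideanSpace ℝ (Fin n))) hp1
    (by rwa [hfin]) h_nonneg h_radial hK h_cpt
  rw [hfin] at hardy
  refine le_trans ?_ hardy
  gcongr _ * ?_
  exact lintegral_div_dist_rpow_le_lintegral_div_norm_rpow volume μ o hBG' (by linarith) hu_meas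
    hK.continuous.measurable h_nonneg h_mono h_level
end

section
/- Let u : M → ℝ be a bounded measurable function with bounded support whose Euclidean rearrangement u* : ℝⁿ → [0,∞) is Lipschitz with compact support. Then (∫_M d(o,q)² u(q)² dμ(q)) · (∫_{ℝⁿ} |∇u*(x)|² dx) ≥ (n²/4) (∫_M u(q)² dμ(q))². -/
open MeasureTheory

/-- Layer-cake formula in `f` for the weighted square integral `∫ r² f²`. -/
theorem lintegral_sq_mul_sq_eq_lintegral_setLIntegral
    {α : Type*} [MeasurableSpace α] (μ : Measure α) {r f : α → ℝ}
    (hr : Measurable r) (hf : Measurable f) (hf0 : ∀ a, 0 ≤ f a) :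
    ∫⁻ a, ENNReal.ofReal (r a ^ 2 * f a ^ 2) ∂μ = ENNReal.ofReal 2 *
      ∫⁻ t in Set.Ioi (0 : ℝ), (∫⁻ a in {a | t < f a}, ENNReal.ofReal (r a ^ 2) ∂μ) *
        ENNReal.ofReal (t ^ ((2 : ℝ) - 1)) := by
  have h := lintegral_rpow_eq_lintegral_meas_lt_mul
    (μ.withDensity fun a => ENNReal.ofReal (r a ^ 2)) (f := f)
    (Filter.Eventually.of_forall hf0) hf.aemeasurable (p := 2) two_pos
  rw [lintegral_withDensity_eq_lintegral_mul _ (by fun_prop) (by fun_prop)] at h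
  simp only [Pi.mul_apply, Real.rpow_two, ← ENNReal.ofReal_mul (sq_nonneg _)] at h
  rw [h]
  congr 2 with t
  rw [withDensity_apply _ (measurableSet_lt measurable_const hf)]

/-- If the truncated superlevel sets of `(f, r)` have measure at most that of those of `(g, s)`,
then the weighted square integrals are ordered accordingly. -/
theorem lintegral_sq_mul_sq_le_of_measure_inter_le
    {α β : Type*} [MeasurableSpace α] [MeasurableSpace β] {μ : Measure α} {ν : Measure β}
    {r f : α → ℝ} {s g : β → ℝ} (hr : Measurable r) (hf : Measurable f)
    (hs : Measurable s) (hg : Measurable g) (hr0 : ∀ a, 0 ≤ r a) (hf0 : ∀ a, 0 ≤ f a)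
    (hs0 : ∀ b, 0 ≤ s b) (hg0 : ∀ b, 0 ≤ g b)
    (h : ∀ t > 0, ∀ ρ > 0,
      μ ({a | t < f a} ∩ {a | ρ ≤ r a}) ≤ ν ({b | t < g b} ∩ {b | ρ ≤ s b})) :
    ∫⁻ a, ENNReal.ofReal (r a ^ 2 * f a ^ 2) ∂μ ≤
      ∫⁻ b, ENNReal.ofReal (s b ^ 2 * g b ^ 2) ∂ν := by
  rw [lintegral_sq_mul_sq_eq_lintegral_setLIntegral μ hr hf hf0,
    lintegral_sq_mul_sq_eq_lintegral_setLIntegral ν hs hg hg0]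
  refine mul_le_mul_right (setLIntegral_mono' measurableSet_Ioi fun t ht => ?_) _
  refine mul_le_mul_left ?_ _
  have h1 := lintegral_rpow_eq_lintegral_meas_le_mul (μ.restrict {a | t < f a})
    (Filter.Eventually.of_forall hr0) hr.aemeasurable (p := 2) two_pos
  have h2 := lintegral_rpow_eq_lintegral_meas_le_mul (ν.restrict {b | t < g b})
    (Filter.Eventually.of_forall hs0) hs.aemeasurable (p := 2) two_pos
  simp only [Real.rpow_two] at h1 h2
  rw [h1, h2]
  refine mul_le_mul_right (setLIntegral_mono' measurableSet_Ioi fun ρ hρ => ?_) _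
  refine mul_le_mul_left ?_ _
  rw [Measure.restrict_apply (measurableSet_le measurable_const hr),
    Measure.restrict_apply (measurableSet_le measurable_const hs), Set.inter_comm,
    Set.inter_comm {b | ρ ≤ s b}]
  exact h t ht ρ hρ

/-- Under the Bishop–Gromov bound, a centred Euclidean ball-like set `S` has no more mass outside
radius `ρ` than any set `A` of the same total mass. -/
theorem volume_superlevel_inter_le {n : ℕ}
    {M : Type*} [MetricSpace M] [MeasurableSpace M] [BorelSpace M]
    (μ : Measure M) (o : M)
    (hBG : ∀ ρ > (0 : ℝ), μ (Metric.ball o ρ) ≤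
      volume (Metric.ball (0 : EuclideanSpace ℝ (Fin n)) 1) * ENNReal.ofReal (ρ ^ n))
    {S : Set (EuclideanSpace ℝ (Fin n))} (hS : ∀ x y, ‖x‖ ≤ ‖y‖ → y ∈ S → x ∈ S)
    {A : Set M} (h : volume S = μ A) {ρ : ℝ} (hρ : 0 < ρ) :
    volume (S ∩ {x | ρ ≤ ‖x‖}) ≤ μ (A ∩ {q | ρ ≤ dist o q}) := by
  rcases (S ∩ {x | ρ ≤ ‖x‖}).eq_empty_or_nonempty with h0 | ⟨y, hy, hyρ⟩
  · simp [h0]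
  have hsub : Metric.ball (0 : EuclideanSpace ℝ (Fin n)) ρ ⊆ S := fun x hx =>
    hS x y ((mem_ball_zero_iff.1 hx).le.trans hyρ) hy
  have e1 : S ∩ {x | ρ ≤ ‖x‖} = S \ Metric.ball 0 ρ := by ext x; simp
  have e2 : A ∩ {q | ρ ≤ dist o q} = A \ Metric.ball o ρ := by ext x; simp [dist_comm]
  rw [e1, e2, measure_sdiff hsub measurableSet_ball.nullMeasurableSet measure_ball_lt_top.ne, h,
    Measure.addHaar_ball_of_pos _ _ hρ, finrank_euclideanSpace_fin, mul_comm]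
  exact (tsub_le_tsub_left (hBG ρ hρ) _).trans le_measure_sdiff

/-- Integration by parts against the radial field: `n ∫ v² = -2 ∫ v ⟨∇v, x⟩`. -/
theorem natCast_mul_integral_sq_eq {n : ℕ} {v : EuclideanSpace ℝ (Fin n) → ℝ} {K : NNReal}
    (hv : LipschitzWith K v) (hc : HasCompactSupport v) :
    n * ∫ x, v x ^ 2 = ∫ x, -2 * v x * fderiv ℝ v x x := by
  obtain ⟨C, hC⟩ := hc.exists_bound_of_continuous hv.continuous
  have hC0 : 0 ≤ C := (norm_nonneg _).trans (hC 0)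
  have hsq : LipschitzWith (2 * C.toNNReal * K) (fun x => v x ^ 2) := by
    refine LipschitzWith.of_dist_le_mul fun x y => ?_
    have h1 := hv.dist_le_mul x y
    rw [Real.dist_eq] at h1 ⊢
    have h2 : |v x + v y| ≤ 2 * C := by
      have := abs_add_le (v x) (v y)
      have := hC x; have := hC y; simp only [Real.norm_eq_abs] at *; linarith
    rw [show v x ^ 2 - v y ^ 2 = (v x + v y) * (v x - v y) by ring, abs_mul]
    push_cast
    rw [Real.coe_toNNReal _ hC0, mul_assoc]
    gcongr
  have hcsq : HasCompactSupport (fun x => v x ^ 2) := hc.comp_left (g := fun t => t ^ 2) (by simp)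
  have hdiff : ∀ᵐ x, DifferentiableAt ℝ v x := hv.ae_differentiableAt
  have key : ∀ i : Fin n, ∫ x, v x ^ 2 =
      ∫ x, -2 * v x * (x i * fderiv ℝ v x (EuclideanSpace.single i 1)) := by
    intro i
    let π : EuclideanSpace ℝ (Fin n) →L[ℝ] ℝ := EuclideanSpace.proj i
    have := π.lipschitz.integral_lineDeriv_mul_eq (μ := volume)
      hsq hcsq (EuclideanSpace.single i (1 : ℝ))
    have hl : ∀ x, lineDeriv ℝ π x
        (EuclideanSpace.single i (1 : ℝ)) = 1 := fun x => by
      rw [(ContinuousLinearMap.differentiableAt _).lineDeriv_eq_fderiv, ContinuousLinearMap.fderiv]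
      simp [π]
    simp only [hl, one_mul] at this
    rw [this]
    refine integral_congr_ae ?_
    filter_upwards [hdiff] with x hx
    have := (hx.hasFDerivAt.pow 2).hasLineDerivAt (-EuclideanSpace.single i (1 : ℝ))
    rw [this.lineDeriv, show π x = x i from rfl]
    simp
    ring
  have h_int : ∀ i ∈ Finset.univ, Integrable fun x =>
      -2 * v x * (x i * fderiv ℝ v x (EuclideanSpace.single (i : Fin n) 1)) := by
    intro i _
    have h1 : Integrable fun x => v x * x i :=
      (hv.continuous.mul (by fun_prop)).integrable_of_hasCompactSupport hc.mul_right
    have h2 := h1.mul_bdd (c := K) (g := fun x => fderiv ℝ v x (EuclideanSpace.single (i : Fin n) 1))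
      (measurable_fderiv_apply_const ℝ v _).aestronglyMeasurable
      (Filter.Eventually.of_forall fun x => by
        simpa using (fderiv ℝ v x).le_of_opNorm_le (norm_fderiv_le_of_lipschitz ℝ hv)
          (EuclideanSpace.single (i : Fin n) 1))
    refine (h2.const_mul (-2)).congr (Filter.Eventually.of_forall fun x => ?_)
    simp only; ring
  calc n * ∫ x, v x ^ 2 = ∑ i : Fin n, ∫ x, v x ^ 2 := by simp
    _ = ∑ i : Fin n, ∫ x, -2 * v x * (x i * fderiv ℝ v x (EuclideanSpace.single i 1)) :=
      Finset.sum_congr rfl fun i _ => key i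
    _ = _ := by
      rw [← integral_finsetSum _ h_int]
      congr with x
      rw [← Finset.mul_sum]
      congr 1
      have hx := congrArg (fderiv ℝ v x) ((EuclideanSpace.basisFun (Fin n) ℝ).sum_repr x)
      simpa [map_sum] using hx

/-- The Heisenberg–Pauli–Weyl inequality for compactly supported Lipschitz functions on `ℝⁿ`. -/
theorem euclidean_heisenberg_pauli_weyl {n : ℕ} {v : EuclideanSpace ℝ (Fin n) → ℝ} {K : NNReal}
    (hv : LipschitzWith K v) (hc : HasCompactSupport v) :
    ENNReal.ofReal ((n : ℝ) ^ 2 / 4) * (∫⁻ x, ENNReal.ofReal (v x ^ 2)) ^ 2 ≤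
      (∫⁻ x, ENNReal.ofReal (‖x‖ ^ 2 * v x ^ 2)) * ∫⁻ x, ENNReal.ofReal (‖fderiv ℝ v x‖ ^ 2) := by
  have hcsq : HasCompactSupport (fun x => v x ^ 2) := hc.comp_left (g := fun t => t ^ 2) (by simp)
  have hi : Integrable (fun x => v x ^ 2) volume :=
    (hv.continuous.pow 2).integrable_of_hasCompactSupport hcsq
  have hI : 0 ≤ ∫ x, v x ^ 2 := integral_nonneg fun x => sq_nonneg _
  have h1 : ENNReal.ofReal (n / 2 * ∫ x, v x ^ 2) ≤
      ∫⁻ x, ENNReal.ofReal (‖x‖ * |v x|) * ENNReal.ofReal ‖fderiv ℝ v x‖ := by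
    have e : n / 2 * ∫ x, v x ^ 2 = ∫ x, -v x * fderiv ℝ v x x := by
      have := natCast_mul_integral_sq_eq hv hc
      simp only [mul_assoc, integral_const_mul] at this
      simp only [neg_mul, integral_neg]
      linarith
    rw [e]
    refine (ENNReal.ofReal_le_ofReal (le_abs_self _)).trans ?_
    rw [← Real.norm_eq_abs, ofReal_norm]
    refine (enorm_integral_le_lintegral_enorm _).trans (lintegral_mono fun x => ?_)
    rw [← ofReal_norm, ← ENNReal.ofReal_mul (by positivity)]
    refine ENNReal.ofReal_le_ofReal ?_
    rw [norm_mul, norm_neg, Real.norm_eq_abs]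
    calc |v x| * ‖fderiv ℝ v x x‖ ≤ |v x| * (‖fderiv ℝ v x‖ * ‖x‖) := by
          gcongr; exact (fderiv ℝ v x).le_opNorm x
      _ = _ := by ring
  have h2 := ENNReal.lintegral_mul_le_Lp_mul_Lq (volume : Measure (EuclideanSpace ℝ (Fin n)))
    Real.HolderConjugate.two_two
    (f := fun x => ENNReal.ofReal (‖x‖ * |v x|)) (g := fun x => ENNReal.ofReal ‖fderiv ℝ v x‖)
    (by have := hv.continuous.measurable; fun_prop)
    ((measurable_fderiv ℝ v).norm.ennreal_ofReal.aemeasurable)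
  have h3 := pow_le_pow_left' (h1.trans h2) 2
  rw [← ofReal_integral_eq_lintegral_ofReal hi (Filter.Eventually.of_forall fun x => sq_nonneg _),
    ← ENNReal.ofReal_pow hI, ← ENNReal.ofReal_mul (by positivity)]
  refine (le_of_eq ?_).trans (h3.trans (le_of_eq ?_))
  · rw [← ENNReal.ofReal_pow (by positivity)]
    congr 1; ring
  · rw [mul_pow, ← ENNReal.rpow_mul_natCast, ← ENNReal.rpow_mul_natCast]
    have hpow : ∀ a : ℝ, 0 ≤ a → ENNReal.ofReal a ^ (2 : ℝ) = ENNReal.ofReal (a ^ 2) :=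
      fun a ha => by rw [ENNReal.rpow_two, ENNReal.ofReal_pow ha]
    simp only [hpow _ (norm_nonneg _), hpow _ (mul_nonneg (norm_nonneg _) (abs_nonneg _)), mul_pow,
      sq_abs]
    norm_num

/-- Heisenberg–Pauli–Weyl step on `M`: for a bounded measurable `u` with bounded support
whose Euclidean rearrangement `ustar` is Lipschitz with compact support,
`(∫_M d(o,·)² u² dμ) (∫_{ℝⁿ} |∇u*|² dx) ≥ (n²/4) (∫_M u² dμ)²`, under Bishop–Gromov. -/
theorem heisenberg_pauli_weyl_via_rearrangement
    {n : ℕ} (hn : 3 ≤ n)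
    {M : Type*} [MetricSpace M] [MeasurableSpace M] [BorelSpace M]
    (μ : Measure M) (o : M)
    (hBG : ∀ ρ > (0 : ℝ), μ (Metric.ball o ρ) ≤
      volume (Metric.ball (0 : EuclideanSpace ℝ (Fin n)) 1) * ENNReal.ofReal (ρ ^ n))
    (u : M → ℝ) (hu_meas : Measurable u)
    (hu_bdd : ∃ C : ℝ, ∀ q, |u q| ≤ C)
    (hu_supp : Bornology.IsBounded (Function.support u))
    (ustar : EuclideanSpace ℝ (Fin n) → ℝ)
    (h_nonneg : ∀ x, 0 ≤ ustar x)
    (h_radial : ∀ x y, ‖x‖ = ‖y‖ → ustar x = ustar y)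
    (h_mono : ∀ x y, ‖x‖ ≤ ‖y‖ → ustar y ≤ ustar x)
    (h_level : ∀ t > (0 : ℝ),
      volume {x | t < ustar x} = μ {q | t < |u q|})
    (h_lip : ∃ K : NNReal, LipschitzWith K ustar)
    (h_cpt : HasCompactSupport ustar) :
    (∫⁻ q, ENNReal.ofReal (dist o q ^ 2 * u q ^ 2) ∂μ) *
        (∫⁻ x, ENNReal.ofReal (‖fderiv ℝ ustar x‖ ^ 2))
      ≥ ENNReal.ofReal ((n : ℝ) ^ 2 / 4) *
          (∫⁻ q, ENNReal.ofReal (u q ^ 2) ∂μ) ^ 2 := by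
  obtain ⟨K, hK⟩ := h_lip
  have hmass : ∫⁻ q, ENNReal.ofReal (u q ^ 2) ∂μ = ∫⁻ x, ENNReal.ofReal (ustar x ^ 2) := by
    have h1 := lintegral_rpow_eq_lintegral_meas_lt_mul μ (f := fun q => |u q|)
      (Filter.Eventually.of_forall fun q => abs_nonneg _) (by fun_prop) (p := 2) two_pos
    have h2 := lintegral_rpow_eq_lintegral_meas_lt_mul volume (f := ustar)
      (Filter.Eventually.of_forall h_nonneg) hK.continuous.measurable.aemeasurable (p := 2) two_pos
    simp only [Real.rpow_two, sq_abs] at h1 h2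
    rw [h1, h2]
    congr 1
    refine setLIntegral_congr_fun measurableSet_Ioi fun t ht => ?_
    simp only [h_level t ht]
  have hmoment : ∫⁻ x, ENNReal.ofReal (‖x‖ ^ 2 * ustar x ^ 2) ≤
      ∫⁻ q, ENNReal.ofReal (dist o q ^ 2 * u q ^ 2) ∂μ := by
    simpa only [sq_abs] using lintegral_sq_mul_sq_le_of_measure_inter_le
      (r := fun x : EuclideanSpace ℝ (Fin n) => ‖x‖) (f := ustar)
      (s := fun q => dist o q) (g := fun q => |u q|)
      measurable_norm hK.continuous.measurable (by fun_prop) (by fun_prop)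
      (fun _ => norm_nonneg _) h_nonneg (fun _ => dist_nonneg) (fun _ => abs_nonneg _)
      fun t ht ρ hρ => volume_superlevel_inter_le μ o hBG
        (fun x y hxy hy => lt_of_lt_of_le hy (h_mono x y hxy)) (h_level t ht) hρ
  rw [ge_iff_le, hmass]
  exact (euclidean_heisenberg_pauli_weyl hK h_cpt).trans (mul_le_mul_left hmoment _)
end

section
/- Let n ≥ 3 and 0 ≤ a < (n−2)/2. For every smooth function u : ℝⁿ → ℝ with compact support contained in ℝⁿ \ {0}, setting w(x) = |x|^{−a} u(x), one has the identity ∫_{ℝⁿ} |x|^{−2a} |∇u(x)|² dx = ∫_{ℝⁿ} |∇w(x)|² dx − a(n−2−a) ∫_{ℝⁿ} w(x)² / |x|² dx. -/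
open MeasureTheory

/-- The integral of the divergence of the vector field `x ↦ g x • x` vanishes. -/
theorem integral_fderiv_apply_self_eq_neg_finrank_mul_integral
    {E : Type*} [NormedAddCommGroup E] [NormedSpace ℝ E] [FiniteDimensional ℝ E]
    [MeasurableSpace E] [BorelSpace E] (μ : Measure E) [μ.IsAddHaarMeasure]
    {g : E → ℝ} (hg : ContDiff ℝ 1 g) (hgc : HasCompactSupport g) :
    ∫ x, fderiv ℝ g x x ∂μ = -(Module.finrank ℝ E * ∫ x, g x ∂μ) := by
  let b := Module.finBasis ℝ E
  let c (i) : E →L[ℝ] ℝ := (b.coord i).toContinuousLinearMap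
  have hg' : Continuous (fderiv ℝ g) := hg.continuous_fderiv (by norm_num)
  have hsum (x : E) : fderiv ℝ g x x = ∑ i, c i x * fderiv ℝ g x (b i) := by
    conv_lhs => arg 2; rw [← b.sum_repr x]
    rw [map_sum]
    simp [c]
  have hint (i) : Integrable (fun x ↦ c i x * fderiv ℝ g x (b i)) μ :=
    ((c i).continuous.mul (hg'.clm_apply continuous_const)).integrable_of_hasCompactSupport
      ((hgc.fderiv_apply ℝ (b i)).mul_left)
  have hparts (i) : ∫ x, c i x * fderiv ℝ g x (b i) ∂μ = -∫ x, g x ∂μ := by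
    have hci (x : E) : fderiv ℝ (c i) x (b i) = 1 := by
      rw [(c i).fderiv]
      simp [c]
    rw [integral_mul_fderiv_eq_neg_fderiv_mul_of_integrable _ (hint i) _
      (fun x _ ↦ (c i).differentiableAt) (fun x _ ↦ hg.differentiable (by norm_num) x)]
    · simp only [hci, one_mul]
    · simp only [hci, one_mul]
      exact hg.continuous.integrable_of_hasCompactSupport hgc
    · exact ((c i).continuous.mul hg.continuous).integrable_of_hasCompactSupport hgc.mul_left
  simp_rw [hsum]
  rw [integral_finsetSum _ fun i _ ↦ hint i]
  simp [hparts]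

theorem hasFDerivAt_norm_rpow_of_ne_zero
    {E : Type*} [NormedAddCommGroup E] [InnerProductSpace ℝ E] (p : ℝ) {x : E} (hx : x ≠ 0) :
    HasFDerivAt (fun y : E ↦ ‖y‖ ^ p) ((p * ‖x‖ ^ (p - 2)) • innerSL ℝ x) x := by
  have hpos : 0 < ‖x‖ := norm_pos_iff.2 hx
  have key (y : E) (q : ℝ) : (‖y‖ ^ 2) ^ q = ‖y‖ ^ (2 * q) := by
    rw [← Real.rpow_natCast, ← Real.rpow_mul (norm_nonneg y)]
    norm_num
  have h := (hasStrictFDerivAt_norm_sq x).hasFDerivAt.rpow_const (p := p / 2)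
    (Or.inl (by positivity))
  simp only [key] at h
  convert h using 1
  · ext y
    congr 1
    ring
  · rw [← Nat.cast_smul_eq_nsmul ℝ 2, smul_smul]
    congr 1
    rw [show 2 * (p / 2 - 1) = p - 2 by ring]
    push_cast
    ring

theorem norm_sub_smul_innerSL_sq
    {E : Type*} [NormedAddCommGroup E] [InnerProductSpace ℝ E] [CompleteSpace E]
    (A : E →L[ℝ] ℝ) (k : ℝ) (x : E) :
    ‖A - k • innerSL ℝ x‖ ^ 2 = ‖A‖ ^ 2 - 2 * k * A x + k ^ 2 * ‖x‖ ^ 2 := by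
  obtain ⟨v, rfl⟩ := (InnerProductSpace.toDual ℝ E).surjective A
  have h : InnerProductSpace.toDual ℝ E v - k • innerSL ℝ x
      = InnerProductSpace.toDual ℝ E (v - k • x) := by
    ext y
    simp
  rw [h, LinearIsometryEquiv.norm_map, LinearIsometryEquiv.norm_map, norm_sub_sq_real,
    norm_smul, inner_smul_right, InnerProductSpace.toDual_apply_apply, mul_pow,
    Real.norm_eq_abs, sq_abs]
  ring

/-- The two Dirichlet integrands differ by `a` times a radial derivative and a zeroth order term. -/
theorem norm_fderiv_norm_rpow_mul_sq
    {E : Type*} [NormedAddCommGroup E] [InnerProductSpace ℝ E] [CompleteSpace E]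
    (a : ℝ) {u : E → ℝ} {x : E} (hx : x ≠ 0) (hu : DifferentiableAt ℝ u x) :
    ‖fderiv ℝ (fun y ↦ ‖y‖ ^ (-a) * u y) x‖ ^ 2
      = ‖x‖ ^ (-(2 * a)) * ‖fderiv ℝ u x‖ ^ 2
        - a * fderiv ℝ (fun y ↦ ‖y‖ ^ (-(2 * a) - 2) * u y ^ 2) x x
        - (a ^ 2 + 2 * a) * (‖x‖ ^ (-(2 * a) - 2) * u x ^ 2) := by
  have hpos : 0 < ‖x‖ := norm_pos_iff.2 hx
  have hw := (hasFDerivAt_norm_rpow_of_ne_zero (-a) hx).mul hu.hasFDerivAt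
  have hG := (hasFDerivAt_norm_rpow_of_ne_zero (-(2 * a) - 2) hx).mul (hu.hasFDerivAt.pow 2)
  have hw' : fderiv ℝ (fun y ↦ ‖y‖ ^ (-a) * u y) x
      = ‖x‖ ^ (-a) • fderiv ℝ u x - (a * ‖x‖ ^ (-a - 2) * u x) • innerSL ℝ x := by
    refine hw.fderiv.trans ?_
    ext y
    simp
    ring
  have hG' : fderiv ℝ (fun y ↦ ‖y‖ ^ (-(2 * a) - 2) * u y ^ 2) x x
      = 2 * ‖x‖ ^ (-(2 * a) - 2) * u x * fderiv ℝ u x x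
        - (2 * a + 2) * ‖x‖ ^ (-(2 * a) - 2 - 2) * ‖x‖ ^ 2 * u x ^ 2 := by
    refine (congrArg (fun L : E →L[ℝ] ℝ ↦ L x) hG.fderiv).trans ?_
    simp
    ring
  have hsub (p : ℝ) : ‖x‖ ^ (p - 2) = ‖x‖ ^ p / ‖x‖ ^ 2 :=
    mod_cast Real.rpow_sub_natCast hpos.ne' p 2
  have hdbl : ‖x‖ ^ (-(2 * a)) = (‖x‖ ^ (-a)) ^ 2 := by
    rw [sq, ← Real.rpow_add hpos]
    ring_nf
  rw [hw', hG', norm_sub_smul_innerSL_sq, norm_smul, Real.norm_eq_abs, mul_pow, sq_abs]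
  simp only [hsub, hdbl, smul_apply, smul_eq_mul]
  field_simp
  ring

/-- A power of the norm times a function supported away from the origin is smooth. -/
theorem contDiff_norm_rpow_mul
    {E : Type*} [NormedAddCommGroup E] [InnerProductSpace ℝ E] {m : WithTop ℕ∞} (p : ℝ)
    {v : E → ℝ} (hv : ContDiff ℝ m v) (h0 : (0 : E) ∉ tsupport v) :
    ContDiff ℝ m (fun x ↦ ‖x‖ ^ p * v x) := by
  refine contDiff_iff_contDiffAt.2 fun x ↦ ?_
  by_cases hx : x ∈ tsupport v
  swap
  · refine contDiffAt_const (c := (0 : ℝ)) |>.congr_of_eventuallyEq ?_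
    filter_upwards [notMem_tsupport_iff_eventuallyEq.1 hx] with y hy
    simp [hy]
  have hx0 : x ≠ 0 := fun h ↦ h0 (h ▸ hx)
  exact ((contDiffAt_norm ℝ hx0).rpow_const_of_ne (norm_ne_zero_iff.2 hx0)).mul hv.contDiffAt

/-- The Euclidean integration-by-parts identity behind the CKN inequality: for `n ≥ 3`,
`0 ≤ a < (n−2)/2`, and smooth `u` with compact support avoiding the origin, setting
`w(x) = |x|^{−a} u(x)` one has
`∫ |x|^{−2a} |∇u|² = ∫ |∇w|² − a(n−2−a) ∫ w²/|x|²`. -/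
theorem ckn_substitution_identity_euclidean
    {n : ℕ} (hn : 3 ≤ n) (a : ℝ) (ha0 : 0 ≤ a) (ha : a < ((n : ℝ) - 2) / 2)
    (u : EuclideanSpace ℝ (Fin n) → ℝ)
    (hu : ContDiff ℝ (⊤ : ℕ∞) u) (hsupp : HasCompactSupport u)
    (h0 : (0 : EuclideanSpace ℝ (Fin n)) ∉ tsupport u)
    (w : EuclideanSpace ℝ (Fin n) → ℝ)
    (hw : ∀ x, w x = ‖x‖ ^ (-a) * u x) :
    ∫ x, ‖x‖ ^ (-(2 * a)) * ‖fderiv ℝ u x‖ ^ 2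
      = (∫ x, ‖fderiv ℝ w x‖ ^ 2)
        - a * ((n : ℝ) - 2 - a) * ∫ x, w x ^ 2 / ‖x‖ ^ 2 := by
  have hsq : (Function.support fun x ↦ u x ^ 2) ⊆ Function.support u :=
    fun x hx ↦ by simpa using hx
  have hG0 : (0 : EuclideanSpace ℝ (Fin n)) ∉ tsupport fun x ↦ u x ^ 2 := fun h ↦
    h0 (closure_mono hsq h)
  let G : EuclideanSpace ℝ (Fin n) → ℝ := fun x ↦ ‖x‖ ^ (-(2 * a) - 2) * u x ^ 2
  have hG : ContDiff ℝ 1 G :=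
    contDiff_norm_rpow_mul _ ((hu.of_le (by exact_mod_cast le_top)).pow 2) hG0
  have hGc : HasCompactSupport G := (hsupp.mono hsq).mul_left
  have hGint : Integrable G := hG.continuous.integrable_of_hasCompactSupport hGc
  have hG'int : Integrable fun x ↦ fderiv ℝ G x x :=
    ((hG.continuous_fderiv (by norm_num)).clm_apply continuous_id).integrable_of_hasCompactSupport
      ((hGc.fderiv ℝ).mono fun x hx h ↦ hx (by simp [h]))
  have hu' : Continuous (fderiv ℝ u) := hu.continuous_fderiv (by simp)
  have hDsupp : (Function.support fun x ↦ ‖fderiv ℝ u x‖ ^ 2) ⊆ tsupport u :=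
    fun x hx ↦ support_fderiv_subset ℝ fun h ↦ hx (by simp [h])
  have hDint : Integrable fun x ↦ ‖x‖ ^ (-(2 * a)) * ‖fderiv ℝ u x‖ ^ 2 := by
    refine Continuous.integrable_of_hasCompactSupport ?_
      (HasCompactSupport.mul_left (hsupp.of_isClosed_subset isClosed_closure
        (closure_minimal hDsupp (isClosed_tsupport u))))
    refine contDiff_zero.1 (contDiff_norm_rpow_mul _ (contDiff_zero.2 (hu'.norm.pow 2)) fun h ↦ ?_)
    exact h0 (closure_minimal hDsupp (isClosed_tsupport u) h)
  have : Nontrivial (EuclideanSpace ℝ (Fin n)) := by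
    have : Nonempty (Fin n) := ⟨⟨0, by lia⟩⟩
    infer_instance
  have hne : ∀ᵐ x : EuclideanSpace ℝ (Fin n), x ≠ 0 := Measure.ae_ne volume 0
  have hwfun : w = fun x ↦ ‖x‖ ^ (-a) * u x := funext hw
  have hDw : ∫ x, ‖fderiv ℝ w x‖ ^ 2
      = ∫ x, (‖x‖ ^ (-(2 * a)) * ‖fderiv ℝ u x‖ ^ 2 - a * fderiv ℝ G x x
        - (a ^ 2 + 2 * a) * G x) := by
    refine integral_congr_ae (hne.mono fun x hx ↦ ?_)
    rw [hwfun]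
    exact norm_fderiv_norm_rpow_mul_sq a hx (hu.differentiable (by simp) x)
  have hwG : ∫ x, w x ^ 2 / ‖x‖ ^ 2 = ∫ x, G x := by
    refine integral_congr_ae (hne.mono fun x hx ↦ ?_)
    have hpos : 0 < ‖x‖ := norm_pos_iff.2 hx
    have h1 : ‖x‖ ^ (-(2 * a) - 2) = ‖x‖ ^ (-(2 * a)) / ‖x‖ ^ 2 :=
      mod_cast Real.rpow_sub_natCast hpos.ne' (-(2 * a)) 2
    have h2 : ‖x‖ ^ (-(2 * a)) = (‖x‖ ^ (-a)) ^ 2 := by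
      rw [sq, ← Real.rpow_add hpos]
      ring_nf
    simp only [hw, G, h1, h2]
    ring
  rw [hDw, hwG, integral_sub (by exact hDint.sub (hG'int.const_mul a)) (hGint.const_mul _),
    integral_sub hDint (hG'int.const_mul a), integral_const_mul, integral_const_mul,
    integral_fderiv_apply_self_eq_neg_finrank_mul_integral volume hG hGc,
    finrank_euclideanSpace_fin]
  ring
end
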